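/- Let A be a local ring and let 0 → Y → X → Σ^n X → 0 be a short exact sequence of homologically finite complexes of A-modules, where Σ denotes the suspension functor. If X has finite CI-dimension, then Y has finite CI-dimension. -/

import Mathlib

open IsLocalRing CategoryTheory

universe u

noncomputable section

/-! Basic commutative-algebra notions: depth, minimal free resolutions, Betti numbers,
complexity, syzygies, reducible complexity, upper reducing degree, Tor-independence,
Gorenstein dimension, CI-dimension, Cohen-Macaulay local rings. -/




/-- The depth of a module over a local ring: the supremum of lengths of regular
sequences on the module consisting of elements of the maximal ideal. -/
def moduleDepth (A : Type u) [CommRing A] [IsLocalRing A]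
    (M : Type u) [AddCommGroup M] [Module A M] : ℕ∞ :=
  sSup {n : ℕ∞ | ∃ rs : List A, (rs.length : ℕ∞) = n ∧
    (∀ x ∈ rs, x ∈ maximalIdeal A) ∧ RingTheory.Sequence.IsRegular M rs}

/-- A minimal free resolution of a module over a local ring. -/
structure MinFreeRes (A : Type u) [CommRing A] [IsLocalRing A]
    (M : Type u) [AddCommGroup M] [Module A M] : Type (u + 1) where
  F : ℕ → ModuleCat.{u} A
  free : ∀ n, Module.Free A (F n)
  fin : ∀ n, Module.Finite A (F n)
  d : ∀ n, F (n + 1) →ₗ[A] F n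
  aug : F 0 →ₗ[A] M
  aug_surj : Function.Surjective aug
  exact_aug : Function.Exact (d 0) aug
  exact_d : ∀ n, Function.Exact (d (n + 1)) (d n)
  minimal : ∀ n x, d n x ∈ (maximalIdeal A) • (⊤ : Submodule A (F n))

/-- The Betti numbers of a minimal free resolution. -/
def MinFreeRes.betti {A : Type u} [CommRing A] [IsLocalRing A]
    {M : Type u} [AddCommGroup M] [Module A M] (R : MinFreeRes A M) (n : ℕ) : ℕ :=
  Module.finrank A (R.F n)

/-- The sequence `β` is eventually bounded by `a * n ^ (t - 1)` for some real `a`. -/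
def CxBound (β : ℕ → ℕ) (t : ℕ) : Prop :=
  ∃ a : ℝ, ∃ N : ℕ, ∀ n, N ≤ n → (β n : ℝ) ≤ a * (n : ℝ) ^ ((t : ℝ) - 1)

/-- The complexity of a module: the least `t` such that the Betti sequence of a minimal
free resolution is eventually bounded by `a * n ^ (t - 1)` for some `a` (and `⊤` if no
such `t` exists). -/
def complexity (A : Type u) [CommRing A] [IsLocalRing A]
    (M : Type u) [AddCommGroup M] [Module A M] : ℕ∞ :=
  sInf {t : ℕ∞ | ∃ t' : ℕ, t = (t' : ℕ∞) ∧ ∃ R : MinFreeRes A M, CxBound R.betti t'}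

/-- A finite resolution of a module `M`:
an exact sequence `0 → G len → ⋯ → G 0 → M → 0`. -/
structure FinRes (A : Type u) [CommRing A]
    (M : Type u) [AddCommGroup M] [Module A M] : Type (u + 1) where
  len : ℕ
  G : ℕ → ModuleCat.{u} A
  d : ∀ n, G (n + 1) →ₗ[A] G n
  aug : G 0 →ₗ[A] M
  bounded : ∀ n, len < n → Subsingleton (G n)
  aug_surj : Function.Surjective aug
  exact_aug : Function.Exact (d 0) aug
  exact_d : ∀ n, Function.Exact (d (n + 1)) (d n)

/-- A module has finite projective dimension if it admits a finite resolution by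
projective modules. -/
def HasFiniteProjDim (A : Type u) [CommRing A]
    (M : Type u) [AddCommGroup M] [Module A M] : Prop :=
  ∃ R : FinRes A M, ∀ n, Module.Projective A (R.G n)

/-- `S` is an `n`-th syzygy of `M`: for `n = 0`, `S ≅ M`; for `n ≥ 1`, `S` is isomorphic to
the image of the `n`-th differential in a minimal free resolution of `M`. -/
def IsSyzygy (A : Type u) [CommRing A] [IsLocalRing A]
    (M : Type u) [AddCommGroup M] [Module A M]
    (S : Type u) [AddCommGroup S] [Module A S] : ℕ → Prop
  | 0 => Nonempty (S ≃ₗ[A] M)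
  | (n + 1) => ∃ R : MinFreeRes A M, Nonempty (S ≃ₗ[A] LinearMap.range (R.d n))

/-- `K` is obtained from `M` by a reduction of complexity coming from a cohomology class
of degree `t ≥ 1`, i.e. there is a short exact sequence `0 → M → K → Ω^{t-1}(M) → 0`. -/
def ReducesWithDeg (A : Type u) [CommRing A] [IsLocalRing A]
    (M K : ModuleCat.{u} A) (t : ℕ) : Prop :=
  1 ≤ t ∧ ∃ (S : Type u) (_ : AddCommGroup S) (_ : Module A S),
    IsSyzygy A M S (t - 1) ∧
    ∃ (f : M →ₗ[A] K) (g : K →ₗ[A] S),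
      Function.Injective f ∧ Function.Surjective g ∧ Function.Exact f g

/-- The class of (bundled) modules having reducible complexity: the smallest class
containing all modules of finite projective dimension, and containing every module `M` of
finite positive complexity admitting a short exact sequence
`0 → M → K → Ω^{t-1}(M) → 0` (coming from a degree-`t` self-extension) with
`cx K < cx M` and `K` of reducible complexity. -/
inductive HasRedCxCat (A : Type u) [CommRing A] [IsLocalRing A] : ModuleCat.{u} A → Prop
  | of_finite_pd (M : ModuleCat.{u} A) : HasFiniteProjDim A M → HasRedCxCat A M
  | of_step (M K : ModuleCat.{u} A) (t : ℕ) :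
      complexity A M ≠ 0 → complexity A M ≠ ⊤ →
      ReducesWithDeg A M K t →
      complexity A K < complexity A M →
      HasRedCxCat A K → HasRedCxCat A M

/-- A module has reducible complexity. -/
def HasReducibleComplexity (A : Type u) [CommRing A] [IsLocalRing A]
    (M : Type u) [AddCommGroup M] [Module A M] : Prop :=
  HasRedCxCat A (ModuleCat.of A M)

/-- A sequence of short exact sequences `0 → K_{i-1} → K_i → Ω^{d_i - 1}(K_{i-1}) → 0`
with strictly decreasing complexities, ending in a module of complexity zero, i.e. a
sequence reducing the complexity of `Ks 0`. -/
def IsReducingSeq (A : Type u) [CommRing A] [IsLocalRing A] (t : ℕ)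
    (Ks : Fin (t + 1) → ModuleCat.{u} A) (degs : Fin t → ℕ) : Prop :=
  (∀ i : Fin t, ReducesWithDeg A (Ks i.castSucc) (Ks i.succ) (degs i)) ∧
  (∀ i : Fin t, complexity A (Ks i.succ) < complexity A (Ks i.castSucc)) ∧
  complexity A (Ks (Fin.last t)) = 0

open Classical in
/-- The upper reducing degree of `M`: `⊤` if `M` has finite projective dimension, and
otherwise the supremum, over all sequences reducing the complexity of `M`, of the minimum
of the degrees of the cohomology classes involved. -/
def upperReducingDegree (A : Type u) [CommRing A] [IsLocalRing A]
    (M : Type u) [AddCommGroup M] [Module A M] : ℕ∞ :=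
  if HasFiniteProjDim A M then ⊤
  else sSup {r : ℕ∞ | ∃ (t : ℕ) (Ks : Fin (t + 1) → ModuleCat.{u} A) (degs : Fin t → ℕ),
    Ks 0 = ModuleCat.of A M ∧ IsReducingSeq A t Ks degs ∧
    r = ⨅ i : Fin t, (degs i : ℕ∞)}

/-- The `n`-th Tor module of two modules. -/
def torModule (A : Type u) [CommRing A] (M N : Type u)
    [AddCommGroup M] [Module A M] [AddCommGroup N] [Module A N] (n : ℕ) : ModuleCat.{u} A :=
  ((Tor (ModuleCat.{u} A) n).obj (ModuleCat.of A M)).obj (ModuleCat.of A N)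

/-- Two modules are Tor-independent if `Tor_n(M, N) = 0` for all `n > 0`. -/
def TorIndep (A : Type u) [CommRing A] (M N : Type u)
    [AddCommGroup M] [Module A M] [AddCommGroup N] [Module A N] : Prop :=
  ∀ n : ℕ, 0 < n → Subsingleton (torModule A M N n)

/-- The `n`-th Ext module of two modules. -/
def extModule (A : Type u) [CommRing A] (M N : Type u)
    [AddCommGroup M] [Module A M] [AddCommGroup N] [Module A N] (n : ℕ) : ModuleCat.{u} A :=
  ((Ext A (ModuleCat.{u} A) n).obj (Opposite.op (ModuleCat.of A M))).obj (ModuleCat.of A N)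

/-- A module `G` has Gorenstein dimension zero if it is reflexive and
`Ext^n(G, A) = 0 = Ext^n(Hom(G, A), A)` for all `n > 0`. -/
def GDimZero (A : Type u) [CommRing A] (G : Type u) [AddCommGroup G] [Module A G] : Prop :=
  Module.IsReflexive A G ∧
  ∀ n : ℕ, 0 < n →
    Subsingleton (extModule A G A n) ∧ Subsingleton (extModule A (Module.Dual A G) A n)

/-- A module has finite Gorenstein dimension if it admits a finite resolution by modules
of Gorenstein dimension zero. -/
def HasFiniteGDim (A : Type u) [CommRing A]
    (M : Type u) [AddCommGroup M] [Module A M] : Prop :=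
  ∃ R : FinRes A M, ∀ n, GDimZero A (R.G n)


/-- The Krull dimension of a ring, viewed in `WithBot ℕ∞`. -/
def ringKrullDimE (A : Type u) [CommRing A] : WithBot ℕ∞ := ringKrullDim A

/-- A local ring is Cohen-Macaulay if its depth equals its Krull dimension. -/
def IsCMLocalRing (A : Type u) [CommRing A] [IsLocalRing A] : Prop :=
  (moduleDepth A A : WithBot ℕ∞) = ringKrullDimE A

/-- A module over a local ring is maximal Cohen-Macaulay if its depth equals the Krull
dimension of the ring. -/
def IsMaxCM (A : Type u) [CommRing A] [IsLocalRing A]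
    (M : Type u) [AddCommGroup M] [Module A M] : Prop :=
  (moduleDepth A M : WithBot ℕ∞) = ringKrullDimE A

/-- A local ring is Gorenstein if and only if every finitely generated module over it has
finite Gorenstein dimension. -/
def IsGorensteinLocalRing (A : Type u) [CommRing A] [IsLocalRing A] : Prop :=
  ∀ M : ModuleCat.{u} A, Module.Finite A M → HasFiniteGDim A M

/-- A module `M` over a local ring `A` has finite CI-dimension if there is a diagram of
local ring homomorphisms `A → R ← Q` with `A → R` flat and `Q → R` surjective with kernel
generated by a regular sequence, such that `R ⊗_A M` has finite projective dimension
over `Q`. -/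
def HasFiniteCIDimMod (A : Type u) [CommRing A] [IsLocalRing A]
    (M : Type u) [AddCommGroup M] [Module A M] : Prop :=
  ∃ (R Q : Type u) (_ : CommRing R) (_ : CommRing Q) (_ : IsLocalRing R) (_ : IsLocalRing Q)
    (f : A →+* R) (g : Q →+* R),
    IsLocalHom f ∧ IsLocalHom g ∧ Function.Surjective g ∧
    (∃ rs : List Q, RingTheory.Sequence.IsRegular Q rs ∧
      RingHom.ker g = Ideal.span {x | x ∈ rs}) ∧
    (letI : Algebra A R := f.toAlgebra
     Module.Flat A R ∧
     (letI : Module Q (TensorProduct A R M) := Module.compHom _ g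
      HasFiniteProjDim Q (TensorProduct A R M)))





/-- A (ℤ-indexed) chain complex of `A`-modules, with differentials of degree `-1`
recorded, Mathlib-style, as a family of maps `d i j : X i → X j` vanishing
unless `j + 1 = i`. -/
structure Cx (A : Type u) [CommRing A] : Type (u + 1) where
  X : ℤ → ModuleCat.{u} A
  d : ∀ i j : ℤ, X i →ₗ[A] X j
  shape : ∀ i j : ℤ, j + 1 ≠ i → d i j = 0
  dsq : ∀ i j k : ℤ, (d j k).comp (d i j) = 0

/-- A chain map between complexes. -/
structure CxHom {A : Type u} [CommRing A] (C D : Cx A) : Type u where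
  f : ∀ i : ℤ, C.X i →ₗ[A] D.X i
  comm : ∀ i j : ℤ, (D.d i j).comp (f i) = (f j).comp (C.d i j)

variable {A : Type u} [CommRing A]

/-- The `n`-th suspension `Σ^n C` of a complex: `(Σ^n C)_i = C_{i-n}`, with differential
multiplied by `(-1)^n`. -/
def Cx.shift (C : Cx A) (n : ℕ) : Cx A where
  X i := C.X (i - n)
  d i j := ((-1 : A) ^ n) • C.d (i - n) (j - n)
  shape i j h := by
    have : (j : ℤ) - n + 1 ≠ i - n := by omega
    show ((-1 : A) ^ n) • C.d (i - n) (j - n) = 0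
    rw [C.shape _ _ this, smul_zero]
  dsq i j k := by
    ext x
    simp only [LinearMap.comp_apply, LinearMap.smul_apply, LinearMap.zero_apply, map_smul]
    rw [← LinearMap.comp_apply (C.d (j - n) (k - n)), C.dsq]
    simp

/-- The cycles of a complex in degree `i`. -/
def Cx.cycles (C : Cx A) (i : ℤ) : Submodule A (C.X i) := LinearMap.ker (C.d i (i - 1))

/-- The boundaries of a complex in degree `i`. -/
def Cx.bnd (C : Cx A) (i : ℤ) : Submodule A (C.X i) := LinearMap.range (C.d (i + 1) i)

/-- The homology of a complex in degree `i`. -/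
def Cx.homology (C : Cx A) (i : ℤ) : Type u :=
  C.cycles i ⧸ ((C.bnd i).comap (C.cycles i).subtype)

instance (C : Cx A) (i : ℤ) : AddCommGroup (C.homology i) :=
  inferInstanceAs (AddCommGroup (C.cycles i ⧸ ((C.bnd i).comap (C.cycles i).subtype)))

instance (C : Cx A) (i : ℤ) : Module A (C.homology i) :=
  inferInstanceAs (Module A (C.cycles i ⧸ ((C.bnd i).comap (C.cycles i).subtype)))

/-- The map induced on homology by a chain map. -/
def CxHom.homologyMap {C D : Cx A} (φ : CxHom C D) (i : ℤ) :
    C.homology i →ₗ[A] D.homology i := by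
  refine Submodule.mapQ _ _ ((φ.f i).restrict (p := C.cycles i) (q := D.cycles i) ?_) ?_
  · intro x hx
    have h := congrArg (fun ψ => ψ x) (φ.comm i (i - 1))
    simp only [LinearMap.comp_apply] at h
    simp only [Cx.cycles, LinearMap.mem_ker] at hx ⊢
    rw [h, hx, map_zero]
  · rintro ⟨x, hx⟩ hmem
    simp only [Submodule.mem_comap, Submodule.subtype_apply] at hmem ⊢
    obtain ⟨y, hy⟩ := hmem
    have h := congrArg (fun ψ => ψ y) (φ.comm (i + 1) i)
    simp only [LinearMap.comp_apply] at h
    refine ⟨φ.f (i + 1) y, ?_⟩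
    rw [h, hy]
    rfl

/-- A chain map is a quasi-isomorphism if it induces isomorphisms on all homology. -/
def CxHom.IsQuasiIso {C D : Cx A} (φ : CxHom C D) : Prop :=
  ∀ i : ℤ, Function.Bijective (φ.homologyMap i)

/-- A complex is homologically finite if its homology is bounded and degreewise
finitely generated. -/
def Cx.HomFinite (C : Cx A) : Prop :=
  (∃ a b : ℤ, ∀ i, (i < a ∨ b < i) → Subsingleton (C.homology i)) ∧
  ∀ i, Module.Finite A (C.homology i)

/-- A bounded below, degreewise finitely generated free complex which is minimal
(the differentials map into `m` times the next module). -/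
def Cx.IsMinFree [IsLocalRing A] (C : Cx A) : Prop :=
  (∃ n₀ : ℤ, ∀ i, i < n₀ → Subsingleton (C.X i)) ∧
  (∀ i, Module.Free A (C.X i) ∧ Module.Finite A (C.X i)) ∧
  (∀ i j (x : C.X i), C.d i j x ∈ (maximalIdeal A) • (⊤ : Submodule A (C.X j)))

/-- `F` is a minimal free resolution of the complex `C`. -/
def IsMinFreeResCx [IsLocalRing A] (F C : Cx A) : Prop :=
  F.IsMinFree ∧ ∃ φ : CxHom F C, φ.IsQuasiIso

/-- A perfect complex: a bounded complex of finitely generated projective modules. -/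
def Cx.IsPerfect (C : Cx A) : Prop :=
  (∃ a b : ℤ, ∀ i, (i < a ∨ b < i) → Subsingleton (C.X i)) ∧
  ∀ i, Module.Finite A (C.X i) ∧ Module.Projective A (C.X i)

/-- A complex has finite projective dimension if it is quasi-isomorphic to a perfect
complex. -/
def Cx.HasFinitePD (C : Cx A) : Prop :=
  ∃ P : Cx A, P.IsPerfect ∧ ∃ φ : CxHom P C, φ.IsQuasiIso

/-- `K` is (isomorphic to) the mapping cone of the chain map `g : C → D`:
there are maps `ι : D → K` and `π : K → ΣC` exhibiting a degreewise split short exact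
sequence `0 → D → K → ΣC → 0`, via a degreewise splitting `s`, such that the
differential of `K` restricted along `s` is given by `g` (up to the sign conventions of
the cone construction). -/
def IsConeOf {A : Type u} [CommRing A] {C D : Cx A} (g : CxHom C D) (K : Cx A) : Prop :=
  ∃ (ι : ∀ i : ℤ, D.X i →ₗ[A] K.X i) (π : ∀ i : ℤ, K.X i →ₗ[A] C.X (i - 1))
    (s : ∀ i : ℤ, C.X (i - 1) →ₗ[A] K.X i),
    (∀ i j : ℤ, (K.d i j).comp (ι i) = (ι j).comp (D.d i j)) ∧
    (∀ i j : ℤ, (π j).comp (K.d i j) = (-1 : A) • ((C.d (i - 1) (j - 1)).comp (π i))) ∧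
    (∀ i, Function.Injective (ι i)) ∧
    (∀ i, (π i).comp (ι i) = 0) ∧
    (∀ i, (π i).comp (s i) = LinearMap.id) ∧
    (∀ i (x : K.X i), ∃ y, x = ι i y + s i (π i x)) ∧
    (∀ i (c : C.X (i - 1)),
      K.d i (i - 1) (s i c) = ι (i - 1) (g.f (i - 1) c) - s (i - 1) (C.d (i - 1) (i - 1 - 1) c))

/-- The complexity of a homologically finite complex: the least `t` such that the Betti
sequence (the ranks of the modules in a minimal free resolution) is eventually bounded by
`a * n ^ (t - 1)` for some `a`. -/
def cxComplexity (A : Type u) [CommRing A] [IsLocalRing A] (C : Cx A) : ℕ∞ :=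
  sInf {t : ℕ∞ | ∃ t' : ℕ, t = (t' : ℕ∞) ∧ ∃ F : Cx A, IsMinFreeResCx F C ∧
    CxBound (fun n => Module.finrank A (F.X (n : ℤ))) t'}

/-- The class of complexes having reducible complexity: the smallest class of
homologically finite complexes containing the complexes of finite projective dimension,
and containing every complex `C` of finite positive complexity admitting a triangle
`C → Σ^n C → K → Σ C` with `n > 0`, `cx K < cx C` and `K` of reducible complexity.
(The triangle is realized by taking the mapping cone of a chain map `F → Σ^n F` for a
minimal free resolution `F` of `C`.) -/
inductive CxRedCx (A : Type u) [CommRing A] [IsLocalRing A] : Cx A → Prop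
  | of_finite_pd (C : Cx A) : C.HasFinitePD → CxRedCx A C
  | of_step (C : Cx A) (n : ℕ) (F : Cx A) (g : CxHom F (F.shift n)) (K : Cx A) :
      0 < n →
      cxComplexity A C ≠ 0 → cxComplexity A C ≠ ⊤ →
      IsMinFreeResCx F C →
      IsConeOf g K →
      cxComplexity A K < cxComplexity A C →
      CxRedCx A K → CxRedCx A C

/-- The base change of a complex of `A`-modules along `A → R`. -/
def Cx.baseChange {A : Type u} [CommRing A] (R : Type u) [CommRing R] [Algebra A R]
    (C : Cx A) : Cx R where
  X i := ModuleCat.of R (TensorProduct A R (C.X i))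
  d i j := (C.d i j).baseChange R
  shape i j h := by
    show (C.d i j).baseChange R = 0
    rw [C.shape i j h, LinearMap.baseChange_zero]
  dsq i j k := by
    show ((C.d j k).baseChange R).comp ((C.d i j).baseChange R) = 0
    rw [← LinearMap.baseChange_comp, C.dsq, LinearMap.baseChange_zero]

/-- The restriction of scalars of a complex of `R`-modules along a ring map `Q → R`. -/
def Cx.restrict {R : Type u} [CommRing R] {Q : Type u} [CommRing Q] (g : Q →+* R)
    (D : Cx R) : Cx Q :=
  letI : ∀ i, Module Q (D.X i) := fun i => Module.compHom _ g
  { X := fun i => ModuleCat.of Q (D.X i)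
    d := fun i j =>
      { toFun := D.d i j
        map_add' := (D.d i j).map_add
        map_smul' := fun q x => (D.d i j).map_smul (g q) x }
    shape := fun i j h => by
      ext x
      show D.d i j x = 0
      rw [D.shape i j h]
      rfl
    dsq := fun i j k => by
      ext x
      show D.d j k (D.d i j x) = 0
      rw [← LinearMap.comp_apply, D.dsq]
      rfl }

/-- A complex `C` over a local ring `A` has finite CI-dimension if there is a diagram of
local ring homomorphisms `A → R ← Q` with `A → R` flat and `Q → R` surjective with kernel
generated by a regular sequence, such that `R ⊗_A C` has finite projective dimension as a
complex of `Q`-modules. -/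
def Cx.HasFiniteCIDim (A : Type u) [CommRing A] [IsLocalRing A] (C : Cx A) : Prop :=
  ∃ (R Q : Type u) (_ : CommRing R) (_ : CommRing Q) (_ : IsLocalRing R) (_ : IsLocalRing Q)
    (f : A →+* R) (g : Q →+* R),
    IsLocalHom f ∧ IsLocalHom g ∧ Function.Surjective g ∧
    (∃ rs : List Q, RingTheory.Sequence.IsRegular Q rs ∧
      RingHom.ker g = Ideal.span {x | x ∈ rs}) ∧
    (letI : Algebra A R := f.toAlgebra
     Module.Flat A R ∧ ((C.baseChange R).restrict g).HasFinitePD)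

/-- The complex `F` is a resolution of the module `M`: it vanishes in negative degrees,
is exact in positive degrees, and has `H₀ ≅ M` via an augmentation map. -/
def IsResolutionOfModule {A : Type u} [CommRing A] (F : Cx A)
    (M : Type u) [AddCommGroup M] [Module A M] : Prop :=
  (∀ i : ℤ, i < 0 → Subsingleton (F.X i)) ∧
  ∃ aug : F.X 0 →ₗ[A] M, Function.Surjective aug ∧ Function.Exact (F.d 1 0) aug ∧
    ∀ i : ℤ, 1 ≤ i → Function.Exact (F.d (i + 1) i) (F.d i (i - 1))

/-- The complex `F` is a free resolution of the module `M`. -/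
def IsFreeResolutionOfModule {A : Type u} [CommRing A] (F : Cx A)
    (M : Type u) [AddCommGroup M] [Module A M] : Prop :=
  IsResolutionOfModule F M ∧ ∀ i, Module.Free A (F.X i) ∧ Module.Finite A (F.X i)

theorem Cx.d_d (C : Cx A) (i j k : ℤ) (x : C.X i) : C.d j k (C.d i j x) = 0 :=
  LinearMap.congr_fun (C.dsq i j k) x

theorem CxHom.comm_apply {C D : Cx A} (φ : CxHom C D) (i j : ℤ) (x : C.X i) :
    D.d i j (φ.f i x) = φ.f j (C.d i j x) :=
  LinearMap.congr_fun (φ.comm i j) x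

/-- Elementwise form of injectivity and surjectivity on homology. -/
theorem CxHom.isQuasiIso_iff {C D : Cx A} (φ : CxHom C D) :
    φ.IsQuasiIso ↔ ∀ i j k : ℤ, j + 1 = i → i + 1 = k →
      (∀ x : C.X i, C.d i j x = 0 → ∀ y : D.X k, D.d k i y = φ.f i x →
        ∃ x' : C.X k, C.d k i x' = x) ∧
      (∀ y : D.X i, D.d i j y = 0 → ∃ x : C.X i, C.d i j x = 0 ∧
        ∃ w : D.X k, φ.f i x = y + D.d k i w) := by
  constructor
  · rintro h i j k hj rfl
    obtain rfl : j = i - 1 := by omega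
    obtain ⟨h1, h2⟩ := h i
    constructor
    · intro x hx y hy
      have h0 : φ.homologyMap i (Submodule.Quotient.mk ⟨x, hx⟩) = 0 :=
        (Submodule.Quotient.mk_eq_zero _).2 ⟨y, hy⟩
      have h3 := (injective_iff_map_eq_zero (φ.homologyMap i)).1 h1 _ h0
      exact (Submodule.Quotient.mk_eq_zero _).1 h3
    · intro y hy
      obtain ⟨q, hq⟩ := h2 (Submodule.Quotient.mk ⟨y, hy⟩)
      obtain ⟨⟨x, hx⟩, rfl⟩ := Submodule.Quotient.mk_surjective _ q
      obtain ⟨w, hw⟩ := (Submodule.Quotient.eq _).1 hq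
      refine ⟨x, hx, w, ?_⟩
      rw [hw]
      change φ.f i x = y + (φ.f i x - y)
      abel
  · intro h i
    obtain ⟨h1, h2⟩ := h i (i - 1) (i + 1) (by omega) rfl
    constructor
    · refine (injective_iff_map_eq_zero (φ.homologyMap i)).2 fun q hq => ?_
      obtain ⟨⟨x, hx⟩, rfl⟩ := Submodule.Quotient.mk_surjective _ q
      obtain ⟨y, hy⟩ := (Submodule.Quotient.mk_eq_zero _).1 hq
      obtain ⟨x', hx'⟩ := h1 x hx y hy
      exact (Submodule.Quotient.mk_eq_zero _).2 ⟨x', hx'⟩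
    · intro q
      obtain ⟨⟨y, hy⟩, rfl⟩ := Submodule.Quotient.mk_surjective _ q
      obtain ⟨x, hx, w, hw⟩ := h2 y hy
      refine ⟨Submodule.Quotient.mk ⟨x, hx⟩, (Submodule.Quotient.eq _).2 ⟨w, ?_⟩⟩
      change D.d (i + 1) i w = φ.f i x - y
      rw [hw]
      abel

/-- A linear map out of a projective module lifts along a linear map whose range contains
the range of the given one. -/
theorem Module.Projective.exists_comp_eq_of_range_le {P M N : Type*} [AddCommGroup P]
    [Module A P] [AddCommGroup M] [Module A M] [AddCommGroup N] [Module A N]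
    [Module.Projective A P] (f : M →ₗ[A] N) (g : P →ₗ[A] N) (h : ∀ x, ∃ y, f y = g x) :
    ∃ l : P →ₗ[A] M, ∀ x, f (l x) = g x := by
  obtain ⟨l, hl⟩ := Module.projective_lifting_property f.rangeRestrict
    (g.codRestrict (LinearMap.range f) h) f.surjective_rangeRestrict
  exact ⟨l, fun x => congrArg Subtype.val (LinearMap.congr_fun hl x)⟩

/-- A chain map from a perfect complex lifts, up to homotopy, along a quasi-isomorphism. -/
theorem CxHom.IsQuasiIso.exists_lift_up_to_homotopy {P W Z : Cx A} (hP : P.IsPerfect)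
    {ψ : CxHom W Z} (hψ : ψ.IsQuasiIso) (f : CxHom P Z) :
    ∃ (g : ∀ i, P.X i →ₗ[A] W.X i) (h : ∀ i, P.X i →ₗ[A] Z.X (i + 1)),
      ∀ i (x : P.X (i + 1)),
        W.d (i + 1) i (g (i + 1) x) = g i (P.d (i + 1) i x) ∧
        f.f (i + 1) x = ψ.f (i + 1) (g (i + 1) x) + Z.d (i + 1 + 1) (i + 1) (h (i + 1) x)
          + h i (P.d (i + 1) i x) := by
  obtain ⟨⟨a, b, hab⟩, hproj⟩ := hP
  have key : ∀ m : ℕ, ∃ (g : ∀ i, P.X i →ₗ[A] W.X i) (h : ∀ i, P.X i →ₗ[A] Z.X (i + 1)),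
      ∀ i, i + 1 < a + m → ∀ x : P.X (i + 1),
        W.d (i + 1) i (g (i + 1) x) = g i (P.d (i + 1) i x) ∧
        f.f (i + 1) x = ψ.f (i + 1) (g (i + 1) x) + Z.d (i + 1 + 1) (i + 1) (h (i + 1) x)
          + h i (P.d (i + 1) i x) := by
    intro m
    induction m with
    | zero =>
      refine ⟨fun _ => 0, fun _ => 0, fun i hi x => ?_⟩
      have := hab (i + 1) (Or.inl (by simpa using hi))
      obtain rfl : x = 0 := Subsingleton.elim _ _
      simp
    | succ m ih =>
      obtain ⟨g, h, hgh⟩ := ih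
      obtain ⟨n, hn⟩ : ∃ n : ℤ, n + 1 = a + m := ⟨a + m - 1, by ring⟩
      have hn' : ∀ i, i < n → ∀ x : P.X (i + 1),
        W.d (i + 1) i (g (i + 1) x) = g i (P.d (i + 1) i x) ∧
        f.f (i + 1) x = ψ.f (i + 1) (g (i + 1) x) + Z.d (i + 1 + 1) (i + 1) (h (i + 1) x)
          + h i (P.d (i + 1) i x) := fun i hi => hgh i (by omega)
      have := (hproj (n + 1)).2
      let F : W.X (n + 1) × Z.X (n + 1 + 1) →ₗ[A] W.X n × Z.X (n + 1) :=
        LinearMap.prod ((W.d (n + 1) n).comp (LinearMap.fst A _ _))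
          (LinearMap.coprod (ψ.f (n + 1)) (Z.d (n + 1 + 1) (n + 1)))
      let G : P.X (n + 1) →ₗ[A] W.X n × Z.X (n + 1) :=
        LinearMap.prod ((g n).comp (P.d (n + 1) n))
          (f.f (n + 1) - (h n).comp (P.d (n + 1) n))
      obtain ⟨l, hl⟩ := Module.Projective.exists_comp_eq_of_range_le F G (by
        intro x
        obtain ⟨k, rfl⟩ : ∃ k, n = k + 1 := ⟨n - 1, by ring⟩
        obtain ⟨e1, e2⟩ := hn' k (by omega) (P.d (k + 1 + 1) (k + 1) x)
        rw [P.d_d, map_zero] at e1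
        rw [P.d_d, map_zero, add_zero] at e2
        have q1 := ((ψ.isQuasiIso_iff.1 hψ) (k + 1) k _ rfl rfl).1 _ e1
          (f.f _ x - h _ (P.d (k + 1 + 1) (k + 1) x)) (by
            rw [map_sub, f.comm_apply, e2]; abel)
        obtain ⟨u, hu⟩ := q1
        obtain ⟨u', hu', w, hw⟩ := ((ψ.isQuasiIso_iff.1 hψ) (k + 1 + 1) (k + 1) _ rfl rfl).2
          (f.f _ x - h _ (P.d (k + 1 + 1) (k + 1) x) - ψ.f _ u) (by
            rw [map_sub, map_sub, f.comm_apply, ψ.comm_apply, hu, e2]; abel)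
        refine ⟨(u + u', -w), Prod.ext ?_ ?_⟩
        · change W.d _ _ (u + u') = g _ (P.d _ _ x)
          rw [map_add, hu, hu', add_zero]
        · change ψ.f _ (u + u') + Z.d _ _ (-w) = f.f _ x - h _ (P.d _ _ x)
          rw [map_add, hw, map_neg]
          abel)
      refine ⟨Function.update g (n + 1) ((LinearMap.fst A _ _).comp l),
        Function.update h (n + 1) ((LinearMap.snd A _ _).comp l), fun i hi x => ?_⟩
      rw [Function.update_of_ne (show i ≠ n + 1 by push_cast at hi; omega),
        Function.update_of_ne (show i ≠ n + 1 by push_cast at hi; omega)]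
      rcases eq_or_ne i n with rfl | hne
      · rw [Function.update_self, Function.update_self]
        have e := hl x
        refine ⟨congrArg Prod.fst e, ?_⟩
        have e2 : ψ.f (i + 1) (l x).1 + Z.d (i + 1 + 1) (i + 1) (l x).2
          = f.f (i + 1) x - h i (P.d (i + 1) i x) := congrArg Prod.snd e
        exact (eq_add_of_sub_eq e2.symm)
      · rw [Function.update_of_ne (show i + 1 ≠ n + 1 by omega),
          Function.update_of_ne (show i + 1 ≠ n + 1 by omega)]
        exact hn' i (by push_cast at hi; omega) x
  obtain ⟨g, h, hgh⟩ := key (b + 1 - a).toNat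
  refine ⟨g, h, fun i x => ?_⟩
  by_cases hi : i + 1 ≤ b
  · exact hgh i (by omega) x
  · have := hab (i + 1) (Or.inr (by omega))
    obtain rfl : x = 0 := Subsingleton.elim _ _
    simp

/-- The desuspended mapping cone `Σ⁻¹ cone(g)` of a chain map `g : P → W`. -/
def CxHom.fiber {P W : Cx A} (g : CxHom P W) : Cx A where
  X i := ModuleCat.of A (P.X i × W.X (i + 1))
  d i j := if hij : j + 1 = i then
    LinearMap.prod ((P.d i j).comp (LinearMap.fst A _ _))
      (LinearMap.coprod (by subst hij; exact g.f (j + 1)) (-W.d (i + 1) (j + 1))) else 0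
  shape i j h := dif_neg h
  dsq i j k := by
    by_cases hij : j + 1 = i
    · by_cases hjk : k + 1 = j
      · subst hij hjk
        rw [dif_pos rfl, dif_pos rfl]
        refine LinearMap.ext fun x => Prod.ext (P.d_d _ _ _ _) ?_
        change g.f (k + 1) (P.d _ _ x.1) + -W.d _ _ (g.f _ x.1 + -W.d _ _ x.2) = 0
        rw [map_add, map_neg, W.d_d, g.comm_apply]
        abel
      · rw [dif_neg hjk, LinearMap.zero_comp]
    · rw [dif_neg hij, LinearMap.comp_zero]

theorem CxHom.fiber_d_apply {P W : Cx A} (g : CxHom P W) (j : ℤ)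
    (x : P.X (j + 1)) (y : W.X (j + 1 + 1)) :
    g.fiber.d (j + 1) j (x, y) =
      (P.d (j + 1) j x, g.f (j + 1) x - W.d (j + 1 + 1) (j + 1) y) := by
  unfold fiber
  dsimp only
  rw [dif_pos rfl, sub_eq_add_neg]
  rfl

theorem CxHom.fiber_isPerfect {P W : Cx A} (g : CxHom P W) (hP : P.IsPerfect)
    (hW : W.IsPerfect) : g.fiber.IsPerfect := by
  obtain ⟨⟨a, b, hab⟩, hP⟩ := hP
  obtain ⟨⟨a', b', hab'⟩, hW⟩ := hW
  refine ⟨⟨min a (a' - 1), max b b', fun i hi => ?_⟩, fun i => ?_⟩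
  · have := hab i (by omega)
    have := hab' (i + 1) (by omega)
    exact inferInstanceAs (Subsingleton (P.X i × W.X (i + 1)))
  · have := (hP i).1
    have := (hP i).2
    have := (hW (i + 1)).1
    have := (hW (i + 1)).2
    exact ⟨inferInstanceAs (Module.Finite A (P.X i × W.X (i + 1))),
      inferInstanceAs (Module.Projective A (P.X i × W.X (i + 1)))⟩

/-- Commutation with the differentials only has to be checked in adjacent degrees. -/
def CxHom.mk' {C D : Cx A} (f : ∀ i : ℤ, C.X i →ₗ[A] D.X i)
    (comm : ∀ j (x : C.X (j + 1)), D.d (j + 1) j (f (j + 1) x) = f j (C.d (j + 1) j x)) :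
    CxHom C D where
  f := f
  comm i j := by
    by_cases h : j + 1 = i
    · subst h
      exact LinearMap.ext (comm j)
    · rw [C.shape i j h, D.shape i j h, LinearMap.zero_comp, LinearMap.comp_zero]

/-- In a short exact sequence of complexes, if the middle and right-hand terms have finite
projective dimension, then so does the left-hand one. -/
theorem Cx.HasFinitePD.of_shortExact {X Y Z : Cx A} (ι : CxHom Y X) (p : CxHom X Z)
    (hinj : ∀ i, Function.Injective (ι.f i))
    (hsurj : ∀ i, Function.Surjective (p.f i))
    (hexact : ∀ i, Function.Exact (ι.f i) (p.f i))
    (hX : X.HasFinitePD) (hZ : Z.HasFinitePD) : Y.HasFinitePD := by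
  obtain ⟨P, hP, φ, hφ⟩ := hX
  obtain ⟨W, hW, ψ, hψ⟩ := hZ
  obtain ⟨g₀, h, hgh⟩ := hψ.exists_lift_up_to_homotopy hP
    (⟨fun i => (p.f i).comp (φ.f i), fun i j => by
      rw [← LinearMap.comp_assoc, p.comm, LinearMap.comp_assoc, φ.comm,
        LinearMap.comp_assoc]⟩ : CxHom P Z)
  let g : CxHom P W := CxHom.mk' g₀ fun j x => (hgh j x).1
  have hg : ∀ j (x : P.X (j + 1)), p.f (j + 1) (φ.f (j + 1) x) = ψ.f (j + 1) (g.f (j + 1) x)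
      + Z.d (j + 1 + 1) (j + 1) (h (j + 1) x) + h j (P.d (j + 1) j x) :=
    fun j x => (hgh j x).2
  clear_value g
  clear hgh
  have hK := g.fiber_isPerfect hP hW
  have hσ : ∀ i k, i + 1 = k → ∃ σ : P.X i × W.X (i + 1) →ₗ[A] X.X k,
      ∀ hk : i + 1 = k, ∀ x, p.f k (σ x) =
        (hk ▸ LinearMap.coprod (h i) (ψ.f (i + 1)) : P.X i × W.X (i + 1) →ₗ[A] Z.X k) x := by
    rintro i k rfl
    have : Module.Projective A (P.X i × W.X (i + 1)) := (hK.2 i).2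
    obtain ⟨σ, hσ⟩ := Module.Projective.exists_comp_eq_of_range_le (p.f (i + 1))
      (LinearMap.coprod (h i) (ψ.f (i + 1))) fun x => hsurj _ _
    exact ⟨σ, fun _ => hσ⟩
  choose σ hσ using hσ
  replace hσ : ∀ i a b, p.f (i + 1) (σ i _ rfl (a, b)) = h i a + ψ.f (i + 1) b :=
    fun i a b => hσ i _ rfl rfl (a, b)
  have hκ : ∀ i j, ∀ hj : j + 1 = i, ∃ κ : P.X i × W.X (i + 1) →ₗ[A] Y.X i, ∀ x,
      ι.f i (κ x) = φ.f i x.1 - X.d (i + 1) i (σ i _ rfl x)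
        - σ j i hj (g.fiber.d i j x) := by
    rintro _ j rfl
    have : Module.Projective A (P.X (j + 1) × W.X (j + 1 + 1)) := (hK.2 (j + 1)).2
    let D : P.X (j + 1) × W.X (j + 1 + 1) →ₗ[A] P.X j × W.X (j + 1) := g.fiber.d (j + 1) j
    refine Module.Projective.exists_comp_eq_of_range_le (ι.f (j + 1))
      ((φ.f (j + 1)).comp (LinearMap.fst A _ _)
        - (X.d (j + 1 + 1) (j + 1)).comp (σ (j + 1) _ rfl)
        - (σ j (j + 1) rfl).comp D) fun x => ?_
    obtain ⟨a, b⟩ := x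
    refine (hexact (j + 1) _).1 ?_
    change p.f _ (φ.f _ a - X.d _ _ (σ (j + 1) _ rfl (a, b))
      - σ j _ rfl (g.fiber.d (j + 1) j (a, b))) = 0
    rw [g.fiber_d_apply, map_sub, map_sub, hσ, ← p.comm_apply, hσ, hg, map_add, map_sub,
      ψ.comm_apply]
    abel
  choose κ₀ hκ₀ using fun i => hκ i (i - 1) (by omega)
  have hκ : ∀ j a b, ι.f (j + 1) (κ₀ (j + 1) (a, b)) = φ.f (j + 1) a
      - X.d (j + 1 + 1) (j + 1) (σ (j + 1) _ rfl (a, b))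
      - σ j (j + 1) rfl (P.d (j + 1) j a, g.f (j + 1) a - W.d (j + 1 + 1) (j + 1) b) := by
    intro j a b
    obtain ⟨i, hi⟩ : ∃ i, i = j + 1 := ⟨_, rfl⟩
    have key : ∀ k (hk : k + 1 = j + 1), k = j → ι.f (j + 1) (κ₀ (j + 1) (a, b)) =
        φ.f (j + 1) a - X.d (j + 1 + 1) (j + 1) (σ (j + 1) _ rfl (a, b))
        - σ k (j + 1) hk (g.fiber.d (j + 1) k (a, b)) →
        ι.f (j + 1) (κ₀ (j + 1) (a, b)) =
        φ.f (j + 1) a - X.d (j + 1 + 1) (j + 1) (σ (j + 1) _ rfl (a, b))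
        - σ j (j + 1) rfl (g.fiber.d (j + 1) j (a, b)) := by
      rintro k hk rfl e
      exact e
    have e := key _ _ (by omega) (hκ₀ (j + 1) (a, b))
    rwa [g.fiber_d_apply] at e
  let κ : CxHom g.fiber Y := CxHom.mk' κ₀ fun j x => by
    obtain ⟨a, b⟩ := x
    obtain ⟨k, rfl⟩ : ∃ k, j = k + 1 := ⟨j - 1, by ring⟩
    apply hinj
    rw [g.fiber_d_apply]
    change ι.f _ (Y.d (k + 1 + 1) (k + 1) (κ₀ (k + 1 + 1) (a, b))) = ι.f _ (κ₀ (k + 1)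
      (P.d (k + 1 + 1) (k + 1) a, g.f _ a - W.d (k + 1 + 1 + 1) (k + 1 + 1) b))
    rw [hκ, ← ι.comm_apply, hκ, map_sub, map_sub, X.d_d, P.d_d, map_sub,
      W.d_d, g.comm_apply, φ.comm_apply, sub_zero, sub_zero, sub_self,
      show ((0 : P.X k), (0 : W.X (k + 1))) = 0 from rfl, map_zero, sub_zero]
  refine ⟨g.fiber, hK, κ, κ.isQuasiIso_iff.2 ?_⟩
  rintro _ j _ rfl rfl
  have hφ' := φ.isQuasiIso_iff.1 hφ
  have hψ' := ψ.isQuasiIso_iff.1 hψ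
  constructor
  · rintro ⟨a, b⟩ hab y hy
    rw [g.fiber_d_apply] at hab
    have ha : P.d (j + 1) j a = 0 := congrArg Prod.fst hab
    have hb : g.f (j + 1) a - W.d (j + 1 + 1) (j + 1) b = 0 := congrArg Prod.snd hab
    have hy' := congrArg (ι.f (j + 1)) hy
    rw [← ι.comm_apply, show κ.f (j + 1) (a, b) = κ₀ (j + 1) (a, b) from rfl, hκ, ha, hb,
      show ((0 : P.X j), (0 : W.X (j + 1))) = 0 from rfl, map_zero, sub_zero] at hy'
    obtain ⟨a₁, ha₁⟩ := (hφ' (j + 1) j _ rfl rfl).1 a ha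
      (ι.f _ y + σ (j + 1) _ rfl (a, b)) (by rw [map_add, hy']; abel)
    obtain ⟨a₂, ha₂, x, hx⟩ := (hφ' (j + 1 + 1) (j + 1) _ rfl rfl).2
      (φ.f _ a₁ - ι.f _ y - σ (j + 1) _ rfl (a, b)) (by
        rw [map_sub, map_sub, φ.comm_apply, ha₁, hy']; abel)
    have e : p.f _ (φ.f _ (a₁ - a₂)) = h _ a + ψ.f _ b - Z.d _ _ (p.f _ x) := by
      rw [map_sub, hx, ← hσ (j + 1) a b, p.comm_apply, ← map_sub, ← sub_eq_zero, ← map_sub]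
      have := (hexact _ _).2 ⟨y, rfl⟩
      rw [← this]
      congr 1
      abel
    have ha₃ : P.d _ (j + 1) (a₁ - a₂) = a := by rw [map_sub, ha₁, ha₂, sub_zero]
    rw [hg, ha₃] at e
    obtain ⟨b', hb'⟩ := (hψ' (j + 1 + 1) (j + 1) _ rfl rfl).1 (g.f _ (a₁ - a₂) - b)
      (by rw [map_sub, g.comm_apply, ha₃, hb])
      (- p.f _ x - h _ (a₁ - a₂)) (by
        generalize a₁ - a₂ = c at e
        rw [map_sub, map_sub, map_neg, ← sub_eq_zero, ← neg_eq_zero, ← sub_eq_zero.2 e]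
        abel)
    refine ⟨(a₁ - a₂, b'), ?_⟩
    rw [g.fiber_d_apply, ha₃, hb', sub_sub_cancel]
  · intro y hy
    obtain ⟨a, ha, x, hx⟩ := (hφ' (j + 1) j _ rfl rfl).2 (ι.f _ y)
      (by rw [ι.comm_apply, hy, map_zero])
    have hga := hg j a
    rw [hx, map_add, (hexact _ _).2 ⟨y, rfl⟩, zero_add, ha, map_zero, add_zero,
      ← p.comm_apply] at hga
    obtain ⟨b, hb⟩ := (hψ' (j + 1) j _ rfl rfl).1 (g.f _ a)
      (by rw [g.comm_apply, ha, map_zero]) (p.f _ x - h _ a)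
      (by rw [map_sub, hga]; abel)
    obtain ⟨b', hb', z, hz⟩ := (hψ' (j + 1 + 1) (j + 1) _ rfl rfl).2
      (p.f _ x - h _ a - ψ.f _ b)
      (by rw [map_sub, map_sub, ψ.comm_apply, hb, hga]; abel)
    obtain ⟨x₂, rfl⟩ := hsurj _ z
    obtain ⟨y₂, hy₂⟩ := (hexact (j + 1 + 1)
      (σ (j + 1) _ rfl (a, b + b') - x - X.d (j + 1 + 1 + 1) (j + 1 + 1) x₂)).1 (by
        rw [map_sub, map_sub, hσ, map_add, hz, ← p.comm_apply]; abel)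
    have hd : g.fiber.d (j + 1) j (a, b + b') = 0 := by
      rw [g.fiber_d_apply, ha, map_add, hb, hb', add_zero, sub_self]
      rfl
    refine ⟨(a, b + b'), hd, -y₂, ?_⟩
    apply hinj
    rw [g.fiber_d_apply] at hd
    rw [show κ.f (j + 1) (a, b + b') = κ₀ (j + 1) (a, b + b') from rfl, hκ, hd, map_add,
      ← ι.comm_apply, map_neg, hy₂, hx]
    simp only [map_neg, map_sub, X.d_d]
    erw [map_zero]
    abel

/-- A complex isomorphic to a suspension of a complex of finite projective dimension has
finite projective dimension. -/
theorem Cx.HasFinitePD.of_equiv_shift {X Z : Cx A} (hX : X.HasFinitePD) (n : ℕ)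
    (e : ∀ i, X.X (i - n) ≃ₗ[A] Z.X i)
    (he : ∀ i j (x : X.X (i - n)),
      Z.d i j (e i x) = e j (((-1 : A) ^ n) • X.d (i - n) (j - n) x)) : Z.HasFinitePD := by
  obtain ⟨P, ⟨⟨a, b, hab⟩, hP⟩, φ, hφ⟩ := hX
  refine ⟨P.shift n, ⟨⟨a + n, b + n, fun i hi => hab (i - n) (by omega)⟩,
    fun i => hP (i - n)⟩, ⟨fun i => (e i).toLinearMap.comp (φ.f (i - n)), fun i j => ?_⟩, ?_⟩
  · refine LinearMap.ext fun (x : P.X (i - n)) => ?_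
    change Z.d i j (e i (φ.f _ x)) = e j (φ.f _ (((-1 : A) ^ n) • P.d _ _ x))
    rw [he, φ.comm_apply, map_smul (φ.f _)]
  · refine (CxHom.isQuasiIso_iff _).2 fun i j k hj hk => ?_
    obtain ⟨h1, h2⟩ := (φ.isQuasiIso_iff.1 hφ) (i - n) (j - n) (k - n) (by omega) (by omega)
    have hu : IsUnit ((-1 : A) ^ n) := isUnit_one.neg.pow n
    constructor
    · intro (x : P.X (i - n)) (hx : (-1 : A) ^ n • P.d _ _ x = 0) y
        (hy : Z.d k i y = e i (φ.f _ x))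
      obtain ⟨y, rfl⟩ := (e k).surjective y
      rw [he, ← map_smul (X.d _ _)] at hy
      obtain ⟨x', hx'⟩ := h1 x (hu.smul_eq_zero.1 hx) _ ((e i).injective hy)
      refine ⟨((hu.unit⁻¹ : Aˣ) : A) • x', ?_⟩
      change (-1 : A) ^ n • P.d (k - n) (i - n) (((hu.unit⁻¹ : Aˣ) : A) • x') = x
      rw [map_smul, hx', smul_smul, IsUnit.mul_val_inv, one_smul]
    · intro y hy
      obtain ⟨y, rfl⟩ := (e i).surjective y
      rw [he, LinearEquiv.map_eq_zero_iff, hu.smul_eq_zero] at hy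
      obtain ⟨x, hx, w, hw⟩ := h2 y hy
      refine ⟨x, (?_ : (-1 : A) ^ n • P.d (i - n) (j - n) x = 0),
        e k (((hu.unit⁻¹ : Aˣ) : A) • w), ?_⟩
      · rw [hx, smul_zero]
      · change e i (φ.f _ x) = _
        rw [he, map_smul (X.d _ _), smul_smul, IsUnit.mul_val_inv, one_smul, hw, map_add]

/-- Base change followed by restriction of scalars, on chain maps. -/
def CxHom.baseChangeRestrict {R Q : Type u} [CommRing R] [Algebra A R] [CommRing Q]
    (g : Q →+* R) {C D : Cx A} (φ : CxHom C D) :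
    CxHom ((C.baseChange R).restrict g) ((D.baseChange R).restrict g) where
  f i :=
    { toFun := (φ.f i).baseChange R
      map_add' := ((φ.f i).baseChange R).map_add
      map_smul' := fun q x => ((φ.f i).baseChange R).map_smul (g q) x }
  comm i j := by
    refine LinearMap.ext fun (x : TensorProduct A R (C.X i)) => ?_
    change (D.d i j).baseChange R ((φ.f i).baseChange R x) =
      (φ.f j).baseChange R ((C.d i j).baseChange R x)
    rw [← LinearMap.comp_apply, ← LinearMap.comp_apply, ← LinearMap.baseChange_comp,
      ← LinearMap.baseChange_comp, φ.comm]

/-- **Proposition 4.4.** Let `0 → Y → X → Σ^n X → 0` be a short exact sequence of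
homologically finite complexes of `A`-modules. If `X` has finite CI-dimension, then so
does `Y`. -/
theorem hasFiniteCIDim_of_ses_with_shift (A : Type u) [CommRing A] [IsNoetherianRing A]
    [IsLocalRing A]
    (X Y : Cx A) (hX : X.HomFinite) (hY : Y.HomFinite)
    (n : ℕ)
    (ι : CxHom Y X) (p : CxHom X (X.shift n))
    (hinj : ∀ i, Function.Injective (ι.f i))
    (hsurj : ∀ i, Function.Surjective (p.f i))
    (hexact : ∀ i, Function.Exact (ι.f i) (p.f i))
    (hci : Cx.HasFiniteCIDim A X) :
    Cx.HasFiniteCIDim A Y := by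
  obtain ⟨R, Q, iR, iQ, lR, lQ, f, g, hf, hg, hgs, hker, hflat, hpd⟩ := hci
  refine ⟨R, Q, iR, iQ, lR, lQ, f, g, hf, hg, hgs, hker, hflat, ?_⟩
  let : Algebra A R := f.toAlgebra
  have : Module.Flat A R := hflat
  refine Cx.HasFinitePD.of_shortExact (ι.baseChangeRestrict g) (p.baseChangeRestrict g)
    (fun i => Module.Flat.lTensor_preserves_injective_linearMap (ι.f i) (hinj i))
    (fun i => LinearMap.lTensor_surjective R (hsurj i))
    (fun i => lTensor_exact R (hexact i) (hsurj i)) hpd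
    (hpd.of_equiv_shift n (fun i => LinearEquiv.refl Q _) fun i j x => ?_)
  change TensorProduct A R (X.X (i - n)) at x
  change ((-1 : A) ^ n • X.d (i - n) (j - n)).baseChange R x =
    g ((-1 : Q) ^ n) • (X.d (i - n) (j - n)).baseChange R x
  rw [LinearMap.baseChange_smul, LinearMap.smul_apply, map_pow, map_neg, map_one]
  rcases n.even_or_odd with h | h
  · rw [h.neg_one_pow, h.neg_one_pow, one_smul, one_smul]
  · rw [h.neg_one_pow, h.neg_one_pow, neg_smul, one_smul]
    exact (neg_one_smul R _).symm
end
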